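/- There exists a constant d (depending only on the universal machine) such that for all n₁, n₂, every nondeterministic communication protocol Π = (𝓡, t) over D = {0,1}^{n₁} × {0,1}^{n₂}, and every (x, y) ∈ D: I(x : y ∣ Π) ≥ I(x : y ∣ t_{x,y}, Π) − log₂ ρ(t_{x,y}) − d·log₂ n − d, where n = max(n₁, n₂). -/

import Mathlib

/-- A machine maps a program and a condition string to at most one output string. -/
abbrev Machine := List Bool → List Bool →. List Bool

/-- Conditional Kolmogorov complexity relative to machine `U`. -/
noncomputable def KC (U : Machine) (x u : List Bool) : ℕ :=
  sInf { k | ∃ p : List Bool, p.length = k ∧ x ∈ U p u }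

/-- `U` is a universal machine. -/
def IsUniversal (U : Machine) : Prop :=
  Partrec₂ U ∧
    ∀ V : Machine, Partrec₂ V →
      ∃ c : ℕ, ∀ p u x, x ∈ V p u → ∃ q : List Bool, x ∈ U q u ∧ q.length ≤ p.length + c

/-- Self-delimiting encoding of a string. -/
def eBits (x : List Bool) : List Bool := (x.map fun b => [b, b]).flatten ++ [true, false]

/-- The fixed computable pairing of strings. -/
def ePair (x y : List Bool) : List Bool := eBits x ++ y

/-- Encoding of a list of strings. -/
def eList (l : List (List Bool)) : List Bool := (l.map eBits).flatten

/-- Conditional mutual information `I(x : y ∣ u)`. -/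
noncomputable def MI (U : Machine) (x y u : List Bool) : ℝ :=
  (KC U x u : ℝ) + KC U y u - KC U (ePair x y) u

/-- Conditional triple information `I(x : y : w ∣ u)`. -/
noncomputable def TI (U : Machine) (x y w u : List Bool) : ℝ :=
  (KC U x u : ℝ) + KC U y u + KC U w u - KC U (ePair x y) u - KC U (ePair x w) u
    - KC U (ePair y w) u + KC U (ePair x (ePair y w)) u

/-- A combinatorial rectangle, given by its list of rows and list of columns. -/
structure Rect where
  rows : List (List Bool)
  cols : List (List Bool)
deriving DecidableEq

/-- Canonical encoding of a rectangle. -/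
def encRect (R : Rect) : List Bool := ePair (eList R.rows) (eList R.cols)

/-- The list of all bit strings of length `n`. -/
def allBV : ℕ → List (List Bool)
  | 0 => [[]]
  | n + 1 => (allBV n).flatMap fun x => [false :: x, true :: x]

/-- A nondeterministic communication protocol over `{0,1}^{n₁} × {0,1}^{n₂}`:
a finite family of rectangles covering the domain together with a transcript
function selecting, for every cell of the domain, a rectangle containing it. -/
structure Protocol (n₁ n₂ : ℕ) where
  rects : List Rect
  trans : List Bool → List Bool → Rect
  rows_len : ∀ R ∈ rects, ∀ s ∈ R.rows, s.length = n₁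
  cols_len : ∀ R ∈ rects, ∀ s ∈ R.cols, s.length = n₂
  trans_mem : ∀ x y : List Bool, x.length = n₁ → y.length = n₂ → trans x y ∈ rects
  trans_row : ∀ x y : List Bool, x.length = n₁ → y.length = n₂ → x ∈ (trans x y).rows
  trans_col : ∀ x y : List Bool, x.length = n₁ → y.length = n₂ → y ∈ (trans x y).cols

/-- The thickness of a cell: the number of rectangles of the protocol containing it. -/
def cellThick {n₁ n₂ : ℕ} (P : Protocol n₁ n₂) (x y : List Bool) : ℕ :=
  P.rects.countP fun R => decide (x ∈ R.rows ∧ y ∈ R.cols)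

/-- The thickness of a rectangle: the maximal thickness of a cell of the rectangle. -/
def rectThick {n₁ n₂ : ℕ} (P : Protocol n₁ n₂) (R : Rect) : ℕ :=
  (R.rows.flatMap fun x => R.cols.map fun y => cellThick P x y).foldr max 0

/-- Canonical encoding of a protocol: the list of its rectangles followed by
the graph of the transcript function on the domain. -/
def encProt {n₁ n₂ : ℕ} (P : Protocol n₁ n₂) : List Bool :=
  ePair (eList (P.rects.map encRect))
    (eList ((allBV n₁).flatMap fun x => (allBV n₂).map fun y => encRect (P.trans x y)))

theorem eBits_append_inj {x y a b : List Bool} (h : eBits x ++ a = eBits y ++ b) :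
    x = y ∧ a = b := by
  induction x generalizing y with
  | nil =>
    cases y with
    | nil => simpa [eBits] using h
    | cons c y => cases c <;> simp [eBits] at h
  | cons c x ih =>
    cases y with
    | nil => cases c <;> simp [eBits] at h
    | cons c' y =>
      simp only [eBits, List.map_cons, List.flatten_cons, List.cons_append, List.nil_append,
        List.cons.injEq] at h
      obtain ⟨h1, -, h2⟩ := h
      obtain ⟨rfl, rfl⟩ := ih h2
      exact ⟨by rw [h1], rfl⟩

theorem ePair_inj {x y a b : List Bool} : ePair x a = ePair y b ↔ x = y ∧ a = b :=
  ⟨eBits_append_inj, fun h => by rw [h.1, h.2]⟩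

theorem eList_injective : Function.Injective eList := by
  intro l
  induction l with
  | nil =>
    intro l' h
    cases l' with
    | nil => rfl
    | cons c y => simp [eBits, eList] at h
  | cons c x ih =>
    intro l' h
    cases l' with
    | nil => simp [eBits, eList] at h
    | cons c' y =>
      simp only [eList, List.map_cons, List.flatten_cons] at h
      obtain ⟨rfl, h2⟩ := eBits_append_inj h
      rw [ih h2]

theorem encRect_injective : Function.Injective encRect := by
  rintro ⟨a, b⟩ ⟨c, d⟩ h
  obtain ⟨h1, h2⟩ := ePair_inj.1 h
  rw [Rect.mk.injEq]
  exact ⟨eList_injective h1, eList_injective h2⟩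

theorem length_ePair (x y : List Bool) : (ePair x y).length = 2 * x.length + 2 + y.length := by
  have : (x.map fun b => [b, b]).flatten.length = 2 * x.length := by
    induction x with
    | nil => rfl
    | cons b x ih => simp only [List.map_cons, List.flatten_cons, List.length_append, ih,
        List.length_cons, List.length_nil]; ring
  simp [ePair, eBits, this]
  ring

/-- A rectangle as a pair of lists. -/
def rectEquiv : Rect ≃ List (List Bool) × List (List Bool) where
  toFun R := (R.rows, R.cols)
  invFun q := ⟨q.1, q.2⟩
  left_inv _ := rfl
  right_inv _ := rfl

instance : Primcodable Rect := Primcodable.ofEquiv _ rectEquiv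

theorem primrec_rows : Primrec Rect.rows :=
  Primrec.fst.comp (Primrec.of_equiv (e := rectEquiv))

theorem primrec_cols : Primrec Rect.cols :=
  Primrec.snd.comp (Primrec.of_equiv (e := rectEquiv))

theorem primrec_eBits : Primrec eBits :=
  Primrec.list_append.comp
    (Primrec.list_flatten.comp <| Primrec.list_map .id <|
      Primrec.list_cons.comp Primrec.snd
        (Primrec.list_cons.comp Primrec.snd (Primrec.const [])))
    (Primrec.const _)

theorem primrec_ePair : Primrec₂ ePair :=
  Primrec.list_append.comp (primrec_eBits.comp Primrec.fst) Primrec.snd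

theorem primrec_eList : Primrec eList :=
  Primrec.list_flatten.comp <| Primrec.list_map .id (primrec_eBits.comp Primrec.snd)

theorem primrec_encRect : Primrec encRect :=
  primrec_ePair.comp (primrec_eList.comp primrec_rows) (primrec_eList.comp primrec_cols)

theorem primrec_two_pow : Primrec fun k : ℕ => 2 ^ k :=
  (Primrec.nat_rec₁ (f := fun _ v => v * 2) 1
    (Primrec.nat_mul.comp Primrec.snd (Primrec.const 2))).of_eq fun n => by
    induction n with
    | zero => rfl
    | succ n ih => rw [pow_succ, ← ih]

theorem primrecRel_mem {β : Type*} [Primcodable β] :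
    PrimrecRel fun (b : β) (l : List β) => b ∈ l :=
  (PrimrecRel.exists_mem_list (R := fun a b : β => a = b) Primrec.eq).swap.of_eq fun b l => by
    simp

/-- The number with binary digits `s`, least significant digit first. -/
def ofBits (s : List Bool) : ℕ := s.foldr (fun b n => 2 * n + b.toNat) 0

theorem primrec_ofBits : Primrec ofBits :=
  Primrec.list_foldr (h := fun _ (q : Bool × ℕ) => 2 * q.2 + q.1.toNat) .id (Primrec.const 0) <|
    Primrec.nat_add.comp
      (Primrec.nat_mul.comp (Primrec.const 2) (Primrec.snd.comp Primrec.snd))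
      ((Primrec.dom_finite Bool.toNat).comp (Primrec.fst.comp Primrec.snd))

theorem exists_ofBits_eq (m N : ℕ) (h : N < 2 ^ m) : ∃ s, s.length = m ∧ ofBits s = N := by
  induction m generalizing N with
  | zero => exact ⟨[], rfl, by simp at h; simp [ofBits, h]⟩
  | succ m ih =>
    obtain ⟨s, h1, h2⟩ := ih (N / 2) (by omega)
    refine ⟨decide (N % 2 = 1) :: s, by simp [h1], ?_⟩
    simp only [ofBits, List.foldr_cons] at h2 ⊢
    rw [h2]
    rcases Nat.mod_two_eq_zero_or_one N with h | h <;> simp [h] <;> omega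

theorem Partrec.exists_steps {α σ : Type*} [Primcodable α] [Primcodable σ] {f : α →. σ}
    (hf : Partrec f) :
    ∃ g : ℕ → α → Option σ, Primrec₂ g ∧ ∀ a x, x ∈ f a ↔ ∃ s, g s a = some x := by
  obtain ⟨c, hc⟩ := Nat.Partrec.Code.exists_code.1 hf
  refine ⟨fun s a => (c.evaln s (Encodable.encode a)).bind Encodable.decode, ?_, fun a x => ?_⟩
  · exact Primrec.option_bind (Nat.Partrec.Code.primrec_evaln.comp
      (((Primrec.fst.pair (Primrec.const c))).pair (Primrec.encode.comp Primrec.snd)))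
      (Primrec.decode.comp Primrec.snd)
  · have key : ∀ v, (∃ s, c.evaln s (Encodable.encode a) = some v) ↔
        ∃ y ∈ f a, Encodable.encode y = v := by
      intro v
      have := Nat.Partrec.Code.evaln_complete (c := c) (n := Encodable.encode a) (x := v)
      simp only [Option.mem_def] at this
      rw [← this, hc]
      simp
    simp only [Option.bind_eq_some_iff]
    constructor
    · intro h
      obtain ⟨s, hs⟩ := (key (Encodable.encode x)).2 ⟨x, h, rfl⟩
      exact ⟨s, _, hs, Encodable.encodek x⟩
    · rintro ⟨s, v, hs, hv⟩
      obtain ⟨y, hy, rfl⟩ := (key v).1 ⟨s, hs⟩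
      rw [Encodable.encodek, Option.some_inj] at hv
      exact hv ▸ hy

theorem Primrec.exists_partrec_leftInverse {α β : Type*} [Primcodable α] [Primcodable β]
    [DecidableEq β] {e : α → β} (he : Primrec e) (hinj : Function.Injective e) :
    ∃ g : β →. α, Partrec g ∧ ∀ a, a ∈ g (e a) := by
  let G : β → ℕ → Option α := fun b n =>
    (Encodable.decode n : Option α).bind fun a => if e a = b then some a else none
  have hG : Primrec₂ G :=
    Primrec.option_bind (Primrec.decode.comp Primrec.snd) <|
      Primrec.ite (Primrec.eq.comp (he.comp Primrec.snd) (Primrec.fst.comp Primrec.fst))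
        (Primrec.option_some.comp Primrec.snd) (Primrec.const none)
  have hGs : ∀ b n a, G b n = some a → e a = b := by
    intro b n a h
    simp only [G, Option.bind_eq_some_iff, Option.ite_none_right_eq_some] at h
    obtain ⟨a', -, h1, h2⟩ := h
    cases h2
    exact h1
  refine ⟨fun b => Nat.rfindOpt (G b), Partrec.rfindOpt hG.to_comp, fun a => ?_⟩
  have hd : (Nat.rfindOpt (G (e a))).Dom :=
    Nat.rfindOpt_dom.2 ⟨Encodable.encode a, a, by simp [G]⟩
  obtain ⟨n, hn⟩ := Nat.rfindOpt_spec (Part.get_mem hd)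
  have := Part.get_mem hd
  rwa [hinj (hGs _ _ _ hn)] at this

/-- The duplicate-free list of the values `f 0, …, f (n - 1)`, in order of appearance. -/
def enumTo {β : Type*} [DecidableEq β] (f : ℕ → Option β) : ℕ → List β
  | 0 => []
  | n + 1 => ((f n).filter (· ∉ enumTo f n)).elim (enumTo f n) fun b => enumTo f n ++ [b]

section enumTo

variable {β : Type*} [DecidableEq β] (f : ℕ → Option β)

theorem nodup_enumTo (n : ℕ) : (enumTo f n).Nodup := by
  induction n with
  | zero => exact List.nodup_nil
  | succ n ih =>
    rw [enumTo]
    cases h : (f n).filter (· ∉ enumTo f n) with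
    | none => exact ih
    | some b =>
      have := (Option.filter_eq_some_iff.1 h).2
      simp only [decide_eq_true_eq] at this
      simpa [List.nodup_append, ih] using fun a ha (hb : a = b) => this (hb ▸ ha)

theorem enumTo_prefix {m n : ℕ} (h : m ≤ n) : enumTo f m <+: enumTo f n := by
  induction h with
  | refl => exact List.prefix_rfl
  | @step n _ ih =>
    refine ih.trans ?_
    rw [enumTo]
    cases (f n).filter (· ∉ enumTo f n) with
    | none => exact List.prefix_rfl
    | some b => exact List.prefix_append _ _

theorem exists_of_mem_enumTo {n : ℕ} {b : β} (h : b ∈ enumTo f n) : ∃ s, f s = some b := by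
  induction n with
  | zero => simp [enumTo] at h
  | succ n ih =>
    rw [enumTo] at h
    cases h' : (f n).filter (· ∉ enumTo f n) with
    | none =>
      rw [h'] at h
      exact ih h
    | some c =>
      simp only [h', Option.elim_some, List.mem_append, List.mem_singleton] at h
      rcases h with h | rfl
      · exact ih h
      · exact ⟨n, (Option.filter_eq_some_iff.1 h').1⟩

theorem mem_enumTo_succ {n : ℕ} {b : β} (h : f n = some b) : b ∈ enumTo f (n + 1) := by
  rw [enumTo, h]
  by_cases hb : b ∈ enumTo f n <;> simp [Option.filter, hb]

/-- The value with index `i` in the enumeration of the values of `f`. -/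
def enumGet (i : ℕ) : Part β := Nat.rfindOpt fun s => (enumTo f s)[i]?

theorem exists_mem_enumGet {n : ℕ} {b : β} (h : b ∈ enumTo f n) :
    ∃ i < (enumTo f n).length, b ∈ enumGet f i := by
  obtain ⟨i, hi, hb⟩ := List.getElem_of_mem h
  refine ⟨i, hi, (Nat.rfindOpt_mono fun {a s t} hst ha => ?_).2 ⟨n, ?_⟩⟩
  · obtain ⟨l, hl⟩ := enumTo_prefix f hst
    simp only [Option.mem_def] at ha ⊢
    rw [← hl]
    obtain ⟨hi, h2⟩ := List.getElem?_eq_some_iff.1 ha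
    rw [List.getElem?_append_left hi, ha]
  · rw [Option.mem_def, List.getElem?_eq_getElem hi, hb]

end enumTo

theorem primrec_enumTo {α β : Type*} [Primcodable α] [Primcodable β] [DecidableEq β]
    {f : α → ℕ → Option β} {t : α → ℕ} (hf : Primrec₂ f) (ht : Primrec t) :
    Primrec fun a => enumTo (f a) (t a) := by
  have hs : Primrec₂ fun (a : α) (q : ℕ × List β) =>
      ((f a q.1).bind fun b => if b ∈ q.2 then none else some (q.2 ++ [b])).getD q.2 := by
    refine Primrec.option_getD.comp (Primrec.option_bind
      (hf.comp Primrec.fst (Primrec.fst.comp Primrec.snd)) ?_) (Primrec.snd.comp Primrec.snd)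
    have h2 : Primrec fun z : (α × ℕ × List β) × β => z.1.2.2 :=
      Primrec.snd.comp (Primrec.snd.comp Primrec.fst)
    exact Primrec.ite (primrecRel_mem.comp Primrec.snd h2) (Primrec.const none)
      (Primrec.option_some.comp (Primrec.list_concat.comp h2 Primrec.snd))
  refine (Primrec.nat_rec' (g := fun _ => []) ht (Primrec.const []) hs).of_eq fun a => ?_
  induction t a with
  | zero => rfl
  | succ n ih =>
    simp only at ih ⊢
    rw [enumTo, ih]
    cases f a n with
    | none => rfl
    | some b => by_cases hb : b ∈ enumTo (f a) n <;> simp [Option.filter, hb]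

theorem partrec_enumGet {α β : Type*} [Primcodable α] [Primcodable β] [DecidableEq β]
    {f : α → ℕ → Option β} {i : α → ℕ} (hf : Primrec₂ f) (hi : Primrec i) :
    Partrec fun a => enumGet (f a) (i a) := by
  have h : Primrec₂ fun a s => (enumTo (f a) s)[i a]? :=
    Primrec.list_getElem?.comp
      (primrec_enumTo (f := fun q : α × ℕ => f q.1)
        (hf.comp (Primrec.fst.comp Primrec.fst) Primrec.snd) Primrec.snd)
      (hi.comp Primrec.fst)
  exact Partrec.rfindOpt h.to_comp

theorem KC_le_length {U : Machine} {p u x : List Bool} (h : x ∈ U p u) : KC U x u ≤ p.length :=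
  Nat.sInf_le ⟨p, rfl, h⟩

theorem IsUniversal.exists_KC_le {U : Machine} (hU : IsUniversal U) {π γ : Type}
    [Primcodable π] [Primcodable γ] {e : γ → List Bool} (he : Primrec e)
    (hinj : Function.Injective e) {F : π × List Bool × γ →. List Bool} (hF : Partrec F) :
    ∃ c : ℕ, ∀ q r g x, x ∈ F (q, r, g) →
      KC U x (e g) ≤ r.length + 2 * (Encodable.encode q).size + c := by
  let e' : (List Bool × List Bool) × γ → List Bool × List Bool :=
    fun a => (ePair a.1.1 a.1.2, e a.2)
  have he' : Primrec e' := (primrec_ePair.comp (Primrec.fst.comp Primrec.fst)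
    (Primrec.snd.comp Primrec.fst)).pair (he.comp Primrec.snd)
  have hinj' : Function.Injective e' := by
    rintro ⟨⟨a, b⟩, c⟩ ⟨⟨a', b'⟩, c'⟩ h
    simp only [e', Prod.mk.injEq, ePair_inj] at h
    rw [h.1.1, h.1.2, hinj h.2]
  obtain ⟨inv, hinv, hmem⟩ := he'.exists_partrec_leftInverse hinj'
  have hV : Partrec₂ fun p u : List Bool => (inv (p, u)).bind fun a =>
      ((Encodable.decode (ofBits a.1.1) : Option π) : Part π).bind fun q => F (q, a.1.2, a.2) := by
    refine Partrec.bind hinv ?_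
    refine Partrec.bind (Computable.ofOption (Primrec.to_comp (Primrec.decode.comp
      (primrec_ofBits.comp (Primrec.fst.comp (Primrec.fst.comp Primrec.snd)))))) ?_
    refine hF.comp (Primrec.to_comp ?_)
    have h2 : Primrec fun z : ((List Bool × List Bool) × ((List Bool × List Bool) × γ)) × π =>
      z.1.2 := Primrec.snd.comp Primrec.fst
    exact Primrec.snd.pair ((Primrec.snd.comp (Primrec.fst.comp h2)).pair (Primrec.snd.comp h2))
  obtain ⟨c, hc⟩ := hU.2 _ hV
  refine ⟨c + 2, fun q r g x hx => ?_⟩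
  obtain ⟨s, hs, hsq⟩ := exists_ofBits_eq _ _ (Nat.lt_size_self (Encodable.encode q))
  obtain ⟨p, hp, hpl⟩ := hc (ePair s r) (e g) x <| Part.mem_bind_iff.2
    ⟨((s, r), g), hmem ((s, r), g), Part.mem_bind_iff.2 ⟨q, by simp [hsq], hx⟩⟩
  rw [length_ePair, hs] at hpl
  have := KC_le_length hp
  omega

theorem IsUniversal.exists_program {U : Machine} (hU : IsUniversal U) (x u : List Bool) :
    ∃ p : List Bool, p.length = KC U x u ∧ x ∈ U p u := by
  obtain ⟨c, hc⟩ := hU.2 (fun p _ => Part.some p) (Computable.fst (α := List Bool)).partrec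
  obtain ⟨q, hq, -⟩ := hc x u x (Part.mem_some x)
  exact Nat.sInf_mem (s := { k | ∃ p : List Bool, p.length = k ∧ x ∈ U p u }) ⟨_, q, rfl, hq⟩

theorem IsUniversal.exists_KC_le_length {U : Machine} (hU : IsUniversal U) :
    ∃ c : ℕ, ∀ x u, KC U x u ≤ x.length + c := by
  obtain ⟨c, hc⟩ := hU.2 (fun p _ => Part.some p) (Computable.fst (α := List Bool)).partrec
  refine ⟨c, fun x u => ?_⟩
  obtain ⟨q, hq, h⟩ := hc x u x (Part.mem_some x)
  exact (KC_le_length hq).trans h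

/-- The strings that `U` outputs under condition `u` on a program of length at most `α`. -/
def simpleStrings (U : Machine) (α : ℕ) (u : List Bool) : Set (List Bool) :=
  { x | ∃ p : List Bool, p.length ≤ α ∧ x ∈ U p u }

theorem mem_allBV (x : List Bool) : x ∈ allBV x.length := by
  induction x with
  | nil => simp [allBV]
  | cons b x ih =>
    rw [List.length_cons, allBV, List.mem_flatMap]
    exact ⟨x, ih, by cases b <;> simp⟩

theorem length_allBV (n : ℕ) : (allBV n).length = 2 ^ n := by
  induction n with
  | zero => rfl
  | succ n ih => simp [allBV, List.length_flatMap, ih, pow_succ]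

theorem exists_simpleStrings_subset (U : Machine) (α : ℕ) (u : List Bool) :
    ∃ X : Finset (List Bool), X.card ≤ 2 ^ (α + 1) ∧ simpleStrings U α u ⊆ X := by
  classical
  refine ⟨((Finset.range (α + 1)).biUnion fun j => (allBV j).toFinset).image
    fun p => if h : (U p u).Dom then (U p u).get h else [], ?_, ?_⟩
  · refine Finset.card_image_le.trans <| Finset.card_biUnion_le.trans ?_
    have h1 : ∀ j ∈ Finset.range (α + 1), (allBV j).toFinset.card ≤ 2 ^ j := fun j _ =>
      (List.toFinset_card_le _).trans (length_allBV j).le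
    exact (Finset.sum_le_sum h1).trans (Nat.geomSum_lt le_rfl (by simp)).le
  · rintro x ⟨p, hp, hx⟩
    simp only [Finset.coe_image, Set.mem_image, Finset.mem_coe, Finset.mem_biUnion,
      Finset.mem_range, List.mem_toFinset]
    refine ⟨p, ⟨p.length, by omega, mem_allBV p⟩, ?_⟩
    rw [dif_pos (Part.dom_iff_mem.2 ⟨x, hx⟩)]
    exact Part.get_eq_of_mem hx _

/-- Search for a simple string in the list `l`, given an approximation `g` of the machine. -/
def simpleSearch (g : ℕ → List Bool × List Bool → Option (List Bool)) (α : ℕ) (u : List Bool)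
    (l : List (List Bool)) (s : ℕ) : Option (List Bool) :=
  (Encodable.decode s : Option (ℕ × List Bool)).bind fun q =>
    (g q.1 (q.2, u)).bind fun y => if q.2.length ≤ α ∧ y ∈ l then some y else none

theorem primrec_simpleSearch {g : ℕ → List Bool × List Bool → Option (List Bool)}
    (hg : Primrec₂ g) {γ : Type*} [Primcodable γ] {α : γ → ℕ} {u : γ → List Bool}
    {l : γ → List (List Bool)} (hα : Primrec α) (hu : Primrec u) (hl : Primrec l) :
    Primrec₂ fun a s => simpleSearch g (α a) (u a) (l a) s := by
  have ha : Primrec fun z : ((γ × ℕ) × (ℕ × List Bool)) × List Bool => z.1.1.1 :=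
    Primrec.fst.comp (Primrec.fst.comp Primrec.fst)
  refine Primrec.option_bind (Primrec.decode.comp Primrec.snd) ?_
  refine Primrec.option_bind (hg.comp (Primrec.fst.comp Primrec.snd) ((Primrec.snd.comp
    Primrec.snd).pair (hu.comp (Primrec.fst.comp Primrec.fst)))) ?_
  refine Primrec.ite (PrimrecPred.and ?_ ?_) (Primrec.option_some.comp Primrec.snd)
    (Primrec.const none)
  · exact Primrec.nat_le.comp (Primrec.list_length.comp (Primrec.snd.comp
      (Primrec.snd.comp Primrec.fst))) (hα.comp ha)
  · exact primrecRel_mem.comp Primrec.snd (hl.comp ha)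

theorem exists_simpleSearch_eq_some {U : Machine}
    {g : ℕ → List Bool × List Bool → Option (List Bool)}
    (hg : ∀ (a : List Bool × List Bool) x, x ∈ U a.1 a.2 ↔ ∃ s, g s a = some x) {α : ℕ}
    {u : List Bool} {l : List (List Bool)} {x : List Bool} :
    (∃ s, simpleSearch g α u l s = some x) ↔ x ∈ simpleStrings U α u ∧ x ∈ l := by
  simp only [simpleSearch, Option.bind_eq_some_iff, Option.ite_none_right_eq_some,
    Option.some_inj]
  constructor
  · rintro ⟨s, ⟨t, p⟩, -, y, hy, ⟨h1, h2⟩, rfl⟩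
    exact ⟨⟨p, h1, (hg (p, u) y).2 ⟨t, hy⟩⟩, h2⟩
  · rintro ⟨⟨p, hp, hx⟩, hl⟩
    obtain ⟨t, ht⟩ := (hg (p, u) x).1 hx
    exact ⟨_, (t, p), Encodable.encodek _, x, ht, ⟨hp, hl⟩, rfl⟩

/-- Conditioned on a rectangle and `u`, an element of one side of the rectangle is described by
its index in the enumeration of the elements of that side that are simple given `u`. -/
theorem IsUniversal.exists_KC_ePair_encRect_le {U : Machine} (hU : IsUniversal U)
    {g : ℕ → List Bool × List Bool → Option (List Bool)} (hg : Primrec₂ g)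
    {side : Rect → List (List Bool)} (hside : Primrec side) :
    ∃ c : ℕ, ∀ (α i n : ℕ) (R : Rect) (u x : List Bool),
      x ∈ enumTo (simpleSearch g α u (side R)) n →
      (enumTo (simpleSearch g α u (side R)) n).length ≤ 2 ^ i →
      KC U x (ePair (encRect R) u) ≤ i + 2 * α.size + c := by
  have hF : Partrec fun a : ℕ × List Bool × Rect × List Bool =>
      enumGet (simpleSearch g a.1 a.2.2.2 (side a.2.2.1)) (ofBits a.2.1) :=
    partrec_enumGet (primrec_simpleSearch hg Primrec.fst
      (Primrec.snd.comp (Primrec.snd.comp Primrec.snd))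
      (hside.comp (Primrec.fst.comp (Primrec.snd.comp Primrec.snd))))
      (primrec_ofBits.comp (Primrec.fst.comp Primrec.snd))
  obtain ⟨c, hc⟩ := hU.exists_KC_le (e := fun a : Rect × List Bool => ePair (encRect a.1) a.2)
    (primrec_ePair.comp (primrec_encRect.comp Primrec.fst) Primrec.snd)
    (fun _ _ h => Prod.ext (encRect_injective (ePair_inj.1 h).1) (ePair_inj.1 h).2) hF
  refine ⟨c, fun α i n R u x hx hi => ?_⟩
  obtain ⟨b, hb, hbx⟩ := exists_mem_enumGet _ hx
  obtain ⟨s, hs, rfl⟩ := exists_ofBits_eq i b (hb.trans_le hi)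
  have := hc α s (R, u) x hbx
  rwa [hs, Encodable.encode_nat] at this

/-- Parameters of the search for a rectangle. -/
abbrev RectParams := ℕ × ℕ × ℕ × ℕ × ℕ

/-- `R` is a rectangle of `L` all of whose cells lie in at most `2 ^ k` rectangles of `L`. -/
def IsThin (L : List Rect) (k : ℕ) (R : Rect) : Prop :=
  R ∈ L ∧ ∀ x ∈ R.rows, ∀ y ∈ R.cols,
    (L.filter fun R' => decide (x ∈ R'.rows ∧ y ∈ R'.cols)).length ≤ 2 ^ k

theorem primrecPred_isThin :
    PrimrecPred fun a : (List Rect × ℕ) × Rect => IsThin a.1.1 a.1.2 a.2 := by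
  have hfilter : Primrec fun z : List Bool × List Bool × List Rect × ℕ =>
      z.2.2.1.filter fun R' => decide (z.1 ∈ R'.rows ∧ z.2.1 ∈ R'.cols) := by
    have hR : PrimrecRel fun (R' : Rect) (q : List Bool × List Bool) =>
        q.1 ∈ R'.rows ∧ q.2 ∈ R'.cols :=
      PrimrecPred.and
        (primrecRel_mem.comp (Primrec.fst.comp Primrec.snd) (primrec_rows.comp Primrec.fst))
        (primrecRel_mem.comp (Primrec.snd.comp Primrec.snd) (primrec_cols.comp Primrec.fst))
    exact hR.listFilter.comp (Primrec.fst.comp (Primrec.snd.comp Primrec.snd))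
      (Primrec.fst.pair (Primrec.fst.comp Primrec.snd))
  have hcell : PrimrecRel fun (y : List Bool) (z : List Bool × List Rect × ℕ) =>
      (z.2.1.filter fun R' => decide (z.1 ∈ R'.rows ∧ y ∈ R'.cols)).length ≤ 2 ^ z.2.2 :=
    Primrec.nat_le.comp
      (Primrec.list_length.comp (hfilter.comp ((Primrec.fst.comp Primrec.snd).pair
        (Primrec.fst.pair (Primrec.snd.comp Primrec.snd)))))
      (primrec_two_pow.comp (Primrec.snd.comp (Primrec.snd.comp Primrec.snd)))
  have hrow : PrimrecRel fun (x : List Bool) (z : List (List Bool) × List Rect × ℕ) =>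
      ∀ y ∈ z.1, (z.2.1.filter fun R' => decide (x ∈ R'.rows ∧ y ∈ R'.cols)).length ≤
        2 ^ z.2.2 :=
    hcell.forall_mem_list.comp (Primrec.fst.comp Primrec.snd)
      (Primrec.fst.pair (Primrec.snd.comp Primrec.snd))
  exact PrimrecPred.and (primrecRel_mem.comp Primrec.snd (Primrec.fst.comp Primrec.fst)) <|
    hrow.forall_mem_list.comp (primrec_rows.comp Primrec.snd)
      ((primrec_cols.comp Primrec.snd).pair Primrec.fst)

open Classical in
/-- Search for a thin rectangle having, for the parameters `(α, β, i, j, k)`, at least `2 ^ i`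
rows of complexity at most `α` and at least `2 ^ j` columns of complexity at most `β`. -/
noncomputable def rectSearch (g : ℕ → List Bool × List Bool → Option (List Bool)) (q : RectParams)
    (L : List Rect) (u : List Bool) (s : ℕ) : Option Rect :=
  (Encodable.decode s : Option (ℕ × Rect)).bind fun b =>
    if IsThin L q.2.2.2.2 b.2 ∧
        2 ^ q.2.2.1 ≤ (enumTo (simpleSearch g q.1 u b.2.rows) b.1).length ∧
        2 ^ q.2.2.2.1 ≤ (enumTo (simpleSearch g q.2.1 u b.2.cols) b.1).length
    then some b.2 else none

theorem primrec_rectSearch {g : ℕ → List Bool × List Bool → Option (List Bool)}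
    (hg : Primrec₂ g) {γ : Type*} [Primcodable γ] {q : γ → RectParams} {L : γ → List Rect}
    {u : γ → List Bool} (hq : Primrec q) (hL : Primrec L) (hu : Primrec u) :
    Primrec₂ fun a s => rectSearch g (q a) (L a) (u a) s := by
  classical
  have ha : Primrec fun z : (γ × ℕ) × (ℕ × Rect) => z.1.1 := Primrec.fst.comp Primrec.fst
  have hR : Primrec fun z : (γ × ℕ) × (ℕ × Rect) => z.2.2 := Primrec.snd.comp Primrec.snd
  have hs : Primrec fun z : (γ × ℕ) × (ℕ × Rect) => z.2.1 := Primrec.fst.comp Primrec.snd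
  have hq' : Primrec fun z : (γ × ℕ) × (ℕ × Rect) => q z.1.1 := hq.comp ha
  have hβ := Primrec.snd.comp hq'
  have hi := Primrec.snd.comp hβ
  have hj := Primrec.snd.comp hi
  refine Primrec.option_bind (Primrec.decode.comp Primrec.snd) ?_
  refine Primrec.ite (PrimrecPred.and ?_ (PrimrecPred.and ?_ ?_))
    (Primrec.option_some.comp hR) (Primrec.const none)
  · exact primrecPred_isThin.comp (((hL.comp ha).pair (Primrec.snd.comp hj)).pair hR)
  · exact Primrec.nat_le.comp (primrec_two_pow.comp (Primrec.fst.comp hi))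
      (Primrec.list_length.comp (primrec_enumTo (primrec_simpleSearch hg
        (Primrec.fst.comp hq') (hu.comp ha) (primrec_rows.comp hR)) hs))
  · exact Primrec.nat_le.comp (primrec_two_pow.comp (Primrec.fst.comp hj))
      (Primrec.list_length.comp (primrec_enumTo (primrec_simpleSearch hg
        (Primrec.fst.comp hβ) (hu.comp ha) (primrec_cols.comp hR)) hs))

theorem rectSearch_eq_some {g : ℕ → List Bool × List Bool → Option (List Bool)} {q : RectParams}
    {L : List Rect} {u : List Bool} {R : Rect} :
    (∃ s, rectSearch g q L u s = some R) ↔ ∃ n, IsThin L q.2.2.2.2 R ∧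
        2 ^ q.2.2.1 ≤ (enumTo (simpleSearch g q.1 u R.rows) n).length ∧
        2 ^ q.2.2.2.1 ≤ (enumTo (simpleSearch g q.2.1 u R.cols) n).length := by
  simp only [rectSearch, Option.bind_eq_some_iff, Option.ite_none_right_eq_some,
    Option.some_inj]
  constructor
  · rintro ⟨s, ⟨n, R'⟩, -, h, rfl⟩
    exact ⟨n, h⟩
  · rintro ⟨n, h⟩
    exact ⟨_, (n, R), Encodable.encodek _, h, rfl⟩

/-- The bound on the length of the index of a rectangle found by `rectSearch`. -/
def indexLength (q : RectParams) : ℕ := q.1 + q.2.1 + 2 + q.2.2.2.2 - (q.2.2.1 + q.2.2.2.1)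

theorem primrec_indexLength : Primrec indexLength :=
  Primrec.nat_sub.comp
    (Primrec.nat_add.comp (Primrec.nat_add.comp (Primrec.nat_add.comp Primrec.fst
      (Primrec.fst.comp Primrec.snd)) (Primrec.const 2))
      (Primrec.snd.comp (Primrec.snd.comp (Primrec.snd.comp Primrec.snd))))
    (Primrec.nat_add.comp (Primrec.fst.comp (Primrec.snd.comp Primrec.snd))
      (Primrec.fst.comp (Primrec.snd.comp (Primrec.snd.comp Primrec.snd))))

/-- Double counting of the pairs formed by a rectangle and a simple cell in it. -/
theorem length_enumTo_rectSearch_le {U : Machine}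
    {g : ℕ → List Bool × List Bool → Option (List Bool)}
    (hg : ∀ (a : List Bool × List Bool) x, x ∈ U a.1 a.2 ↔ ∃ s, g s a = some x)
    (α β i j k : ℕ) (L : List Rect) (u : List Bool) (n : ℕ) :
    (enumTo (rectSearch g (α, β, i, j, k) L u) n).length * 2 ^ (i + j) ≤
      2 ^ (α + β + 2 + k) := by
  classical
  obtain ⟨X, hX, hXs⟩ := exists_simpleStrings_subset U α u
  obtain ⟨Y, hY, hYs⟩ := exists_simpleStrings_subset U β u
  rw [← List.toFinset_card_of_nodup (nodup_enumTo _ n)]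
  set T := (enumTo (rectSearch g (α, β, i, j, k) L u) n).toFinset
  have hT : ∀ R ∈ T, ∃ n, IsThin L k R ∧
      2 ^ i ≤ (enumTo (simpleSearch g α u R.rows) n).length ∧
      2 ^ j ≤ (enumTo (simpleSearch g β u R.cols) n).length := fun R hR =>
    rectSearch_eq_some.1 (exists_of_mem_enumTo _ (List.mem_toFinset.1 hR))
  have key : ∀ (γ l : ℕ) (Z : Finset (List Bool)) (_ : simpleStrings U γ u ⊆ Z)
      (side : List (List Bool)) (m : ℕ),
      2 ^ l ≤ (enumTo (simpleSearch g γ u side) m).length →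
      2 ^ l ≤ (Z.filter (· ∈ side)).card := by
    intro γ l Z hZ side m hm
    refine hm.trans ?_
    rw [← List.toFinset_card_of_nodup (nodup_enumTo _ m)]
    refine Finset.card_le_card fun x hx => ?_
    obtain ⟨h1, h2⟩ := (exists_simpleSearch_eq_some hg).1
      (exists_of_mem_enumTo _ (List.mem_toFinset.1 hx))
    exact Finset.mem_filter.2 ⟨hZ h1, h2⟩
  let r : Rect → List Bool × List Bool → Prop := fun R z => z.1 ∈ R.rows ∧ z.2 ∈ R.cols
  have hlow : ∀ R ∈ T, 2 ^ (i + j) ≤ ((X ×ˢ Y).bipartiteAbove r R).card := by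
    intro R hR
    obtain ⟨m, -, h1, h2⟩ := hT R hR
    have : (X ×ˢ Y).bipartiteAbove r R = X.filter (· ∈ R.rows) ×ˢ Y.filter (· ∈ R.cols) :=
      Finset.filter_product _ _
    rw [this, Finset.card_product, pow_add]
    exact Nat.mul_le_mul (key α i X hXs _ m h1) (key β j Y hYs _ m h2)
  have hup : ∀ z ∈ X ×ˢ Y, (T.bipartiteBelow r z).card ≤ 2 ^ k := by
    intro z _
    rcases (T.bipartiteBelow r z).eq_empty_or_nonempty with h | ⟨R, hR⟩
    · simp [h]
    · obtain ⟨hR, hz⟩ := Finset.mem_filter.1 hR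
      obtain ⟨-, hthin, -⟩ := hT R hR
      refine le_trans ?_ (hthin.2 z.1 hz.1 z.2 hz.2)
      refine le_trans (Finset.card_le_card fun R' hR' => ?_) (List.toFinset_card_le _)
      obtain ⟨hR', hz'⟩ := Finset.mem_filter.1 hR'
      obtain ⟨-, hthin', -⟩ := hT R' hR'
      simp only [List.mem_toFinset, List.mem_filter, decide_eq_true_eq]
      exact ⟨hthin'.1, hz'⟩
  refine (Finset.card_mul_le_card_mul r hlow hup).trans ?_
  calc (X ×ˢ Y).card * 2 ^ k ≤ (2 ^ (α + 1) * 2 ^ (β + 1)) * 2 ^ k := by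
        rw [Finset.card_product]
        gcongr
    _ = 2 ^ (α + β + 2 + k) := by ring

/-- A rectangle found by `rectSearch` is described by its index in the enumeration. -/
theorem IsUniversal.exists_KC_le_indexLength_add {U : Machine} (hU : IsUniversal U)
    {g : ℕ → List Bool × List Bool → Option (List Bool)} (hg : Primrec₂ g)
    (hgU : ∀ (a : List Bool × List Bool) x, x ∈ U a.1 a.2 ↔ ∃ s, g s a = some x) :
    ∃ c : ℕ, ∀ (q : RectParams) (L : List Rect) (z : List Bool) (R : Rect) (v : List Bool),
      (∃ s, rectSearch g q L (ePair (eList (L.map encRect)) z) s = some R) →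
      KC U v (ePair (eList (L.map encRect)) z) + (q.2.2.1 + q.2.2.2.1) ≤
        q.1 + q.2.1 + q.2.2.2.2 +
          KC U v (ePair (encRect R) (ePair (eList (L.map encRect)) z)) +
          2 * (Encodable.encode q).size + c := by
  let e : List Rect × List Bool → List Bool := fun a => ePair (eList (a.1.map encRect)) a.2
  have he : Primrec e := primrec_ePair.comp (primrec_eList.comp (Primrec.list_map Primrec.fst
    (primrec_encRect.comp Primrec.snd))) Primrec.snd
  have hinj : Function.Injective e := fun a b h => Prod.ext
    (List.map_injective_iff.2 encRect_injective (eList_injective (ePair_inj.1 h).1))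
    (ePair_inj.1 h).2
  have hF : Partrec fun a : RectParams × List Bool × List Rect × List Bool =>
      (enumGet (rectSearch g a.1 a.2.2.1 (e a.2.2)) (ofBits (a.2.1.take (indexLength a.1)))).bind
        fun R => U (a.2.1.drop (indexLength a.1)) (ePair (encRect R) (e a.2.2)) := by
    have hm : Primrec fun a : RectParams × List Bool × List Rect × List Bool =>
        indexLength a.1 := primrec_indexLength.comp Primrec.fst
    have hr : Primrec fun a : RectParams × List Bool × List Rect × List Bool => a.2.1 :=
      Primrec.fst.comp Primrec.snd
    have hz : Primrec fun a : RectParams × List Bool × List Rect × List Bool => a.2.2 :=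
      Primrec.snd.comp Primrec.snd
    refine Partrec.bind (partrec_enumGet (primrec_rectSearch hg Primrec.fst
      (Primrec.fst.comp hz) (he.comp hz))
      (primrec_ofBits.comp (Primrec.list_take.comp hm hr))) ?_
    exact hU.1.comp ((Primrec.list_drop.comp hm hr).comp Primrec.fst).to_comp
      (primrec_ePair.comp (primrec_encRect.comp Primrec.snd)
        ((he.comp hz).comp Primrec.fst)).to_comp
  obtain ⟨c, hc⟩ := hU.exists_KC_le he hinj hF
  refine ⟨c + 2, fun q L z R v ⟨t, hR⟩ => ?_⟩
  have hmem := mem_enumTo_succ _ hR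
  set E := enumTo (rectSearch g q L (ePair (eList (L.map encRect)) z)) (t + 1)
  obtain ⟨α, β, i, j, k⟩ := q
  have hcount : E.length * 2 ^ (i + j) ≤ 2 ^ (α + β + 2 + k) :=
    length_enumTo_rectSearch_le hgU α β i j k L _ _
  have hij : i + j ≤ α + β + 2 + k := by
    refine (Nat.pow_le_pow_iff_right (by norm_num : 1 < 2)).1 (le_trans ?_ hcount)
    exact Nat.le_mul_of_pos_left _ (List.length_pos_of_mem hmem)
  have hlen : E.length ≤ 2 ^ indexLength (α, β, i, j, k) := by
    refine Nat.le_of_mul_le_mul_right (c := 2 ^ (i + j)) (hcount.trans ?_) (by positivity)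
    rw [← pow_add, indexLength, Nat.sub_add_cancel hij]
  obtain ⟨b, hb, hbR⟩ := exists_mem_enumGet _ hmem
  obtain ⟨s, hs, rfl⟩ := exists_ofBits_eq _ b (hb.trans_le hlen)
  obtain ⟨p, hp, hpv⟩ := hU.exists_program v
    (ePair (encRect R) (ePair (eList (L.map encRect)) z))
  have := hc (α, β, i, j, k) (s ++ p) (L, z) v <| Part.mem_bind_iff.2 ⟨R, by
    simpa only [List.take_left' hs] using hbR, by
    simpa only [List.drop_left' hs] using hpv⟩
  simp only [e, List.length_append, hs, hp, indexLength] at this ⊢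
  omega

theorem Nat.pair_lt_two_pow {a b s : ℕ} (ha : a < 2 ^ s) (hb : b < 2 ^ s) :
    Nat.pair a b < 2 ^ (2 * s) := by
  refine (Nat.pair_lt_max_add_one_sq a b).trans_le ?_
  rw [mul_comm, pow_mul]
  exact Nat.pow_le_pow_left (max_lt ha hb) 2

theorem size_encode_rectParams_le {α β i j k S : ℕ} (hα : α < 2 ^ S) (hβ : β < 2 ^ S)
    (hi : i < 2 ^ S) (hj : j < 2 ^ S) (hk : k < 2 ^ S) :
    (Encodable.encode ((α, β, i, j, k) : RectParams)).size ≤ 16 * S := by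
  have mono : ∀ {a m : ℕ}, a < 2 ^ S → S ≤ m → a < 2 ^ m := fun h hm =>
    h.trans_le (Nat.pow_le_pow_right two_pos hm)
  have h := Nat.pair_lt_two_pow (mono hα (by omega)) <| Nat.pair_lt_two_pow (mono hβ (by omega)) <|
    Nat.pair_lt_two_pow (mono hi (by omega)) <| Nat.pair_lt_two_pow hj hk
  rw [Nat.size_le]
  exact h.trans_eq (by ring)

theorem List.le_foldr_max {l : List ℕ} {a : ℕ} (h : a ∈ l) : a ≤ l.foldr max 0 := by
  induction l with
  | nil => simp at h
  | cons b l ih =>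
    rcases List.mem_cons.1 h with rfl | h
    · exact le_max_left _ _
    · exact (ih h).trans (le_max_right _ _)

theorem cellThick_le_rectThick {n₁ n₂ : ℕ} (P : Protocol n₁ n₂) {R : Rect} {x y : List Bool}
    (hx : x ∈ R.rows) (hy : y ∈ R.cols) : cellThick P x y ≤ rectThick P R :=
  List.le_foldr_max (List.mem_flatMap.2 ⟨x, hx, List.mem_map.2 ⟨y, hy, rfl⟩⟩)

theorem isThin_of_rectThick_le {n₁ n₂ k : ℕ} {P : Protocol n₁ n₂} {R : Rect} (hR : R ∈ P.rects)
    (hk : rectThick P R ≤ 2 ^ k) : IsThin P.rects k R := by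
  refine ⟨hR, fun x hx y hy => ?_⟩
  rw [← List.countP_eq_length_filter]
  exact (cellThick_le_rectThick P hx hy).trans hk

theorem length_enumTo_simpleSearch_le {U : Machine}
    {g : ℕ → List Bool × List Bool → Option (List Bool)}
    (hg : ∀ (a : List Bool × List Bool) x, x ∈ U a.1 a.2 ↔ ∃ s, g s a = some x)
    (α n : ℕ) (u : List Bool) (l : List (List Bool)) :
    (enumTo (simpleSearch g α u l) n).length ≤ 2 ^ (α + 1) := by
  obtain ⟨X, hX, hXs⟩ := exists_simpleStrings_subset U α u
  rw [← List.toFinset_card_of_nodup (nodup_enumTo _ n)]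
  refine (Finset.card_le_card fun x hx => hXs ?_).trans hX
  exact ((exists_simpleSearch_eq_some hg).1
    (exists_of_mem_enumTo _ (List.mem_toFinset.1 hx))).1

theorem IsUniversal.exists_KC_add_le {U : Machine} (hU : IsUniversal U) :
    ∃ C : ℕ, ∀ (n₁ n₂ : ℕ) (P : Protocol n₁ n₂) (R : Rect) (x y v : List Bool) (k S : ℕ),
      R ∈ P.rects → x ∈ R.rows → y ∈ R.cols → rectThick P R ≤ 2 ^ k →
      KC U x (encProt P) + 1 < 2 ^ S → KC U y (encProt P) + 1 < 2 ^ S → k < 2 ^ S →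
      KC U x (ePair (encRect R) (encProt P)) + KC U y (ePair (encRect R) (encProt P)) +
          KC U v (encProt P) ≤
        KC U x (encProt P) + KC U y (encProt P) + KC U v (ePair (encRect R) (encProt P)) + k +
          36 * S + C := by
  obtain ⟨g, hg, hgU⟩ := Partrec.exists_steps
    (f := fun a : List Bool × List Bool => U a.1 a.2) hU.1
  obtain ⟨c₁, hc₁⟩ := hU.exists_KC_ePair_encRect_le hg primrec_rows
  obtain ⟨c₂, hc₂⟩ := hU.exists_KC_ePair_encRect_le hg primrec_cols
  obtain ⟨c₃, hc₃⟩ := hU.exists_KC_le_indexLength_add hg hgU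
  refine ⟨c₁ + c₂ + c₃ + 2, fun n₁ n₂ P R x y v k S hR hx hy hk hxS hyS hkS => ?_⟩
  have hdescr : ∀ (z : List Bool) (l : List (List Bool)), z ∈ l →
      ∃ n, z ∈ enumTo (simpleSearch g (KC U z (encProt P)) (encProt P) l) n := by
    intro z l hz
    obtain ⟨p, hp, hpz⟩ := hU.exists_program z (encProt P)
    obtain ⟨s, hs⟩ := (exists_simpleSearch_eq_some hgU).2 ⟨⟨p, hp.le, hpz⟩, hz⟩
    exact ⟨s + 1, mem_enumTo_succ _ hs⟩
  obtain ⟨nx, hnx⟩ := hdescr x _ hx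
  obtain ⟨ny, hny⟩ := hdescr y _ hy
  have hnx' := (enumTo_prefix _ (le_max_left nx ny)).subset hnx
  have hny' := (enumTo_prefix _ (le_max_right nx ny)).subset hny
  have hlenx := length_enumTo_simpleSearch_le hgU (KC U x (encProt P)) (max nx ny)
    (encProt P) R.rows
  have hleny := length_enumTo_simpleSearch_le hgU (KC U y (encProt P)) (max nx ny)
    (encProt P) R.cols
  have h₁ := hc₁ _ _ _ _ _ _ hnx' (Nat.lt_pow_succ_log_self one_lt_two _).le
  have h₂ := hc₂ _ _ _ _ _ _ hny' (Nat.lt_pow_succ_log_self one_lt_two _).le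
  have hix := Nat.pow_log_le_self 2 (List.length_pos_of_mem hnx').ne'
  have hiy := Nat.pow_log_le_self 2 (List.length_pos_of_mem hny').ne'
  have hix' := (Nat.pow_le_pow_iff_right one_lt_two).1 (hix.trans hlenx)
  have hiy' := (Nat.pow_le_pow_iff_right one_lt_two).1 (hiy.trans hleny)
  set α := KC U x (encProt P)
  set β := KC U y (encProt P)
  set i := Nat.log 2 (enumTo (simpleSearch g α (encProt P) R.rows) (max nx ny)).length
  set j := Nat.log 2 (enumTo (simpleSearch g β (encProt P) R.cols) (max nx ny)).length
  have h₃ := hc₃ (α, β, i, j, k) P.rects _ R v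
    (rectSearch_eq_some.2 ⟨max nx ny, isThin_of_rectThick_le hR hk, hix, hiy⟩)
  have hα : α.size ≤ S := Nat.size_le.2 (by omega)
  have hβ : β.size ≤ S := Nat.size_le.2 (by omega)
  have hq := size_encode_rectParams_le (α := α) (β := β) (i := i) (j := j) (S := S)
    (by omega) (by omega) (by omega) (by omega) hkS
  rw [← encProt] at h₃
  simp only at h₃
  omega

/-- The binary length of an affine function of `n` is at most `log₂ n` up to a constant. -/
theorem exists_log_affine_le (a b : ℕ) :
    ∃ D : ℝ, 0 ≤ D ∧ ∀ n : ℕ, (Nat.log 2 (a * n + b + 1) : ℝ) ≤ Real.logb 2 n + D := by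
  have hab : (1 : ℝ) ≤ a + b + 1 := by
    have : (0 : ℝ) ≤ a + b := by positivity
    linarith
  refine ⟨Real.logb 2 (a + b + 1), Real.logb_nonneg one_lt_two hab, fun n => ?_⟩
  refine (Real.natLog_le_logb _ _).trans ?_
  push_cast
  rcases Nat.eq_zero_or_pos n with rfl | hn
  · simp only [Nat.cast_zero, mul_zero, zero_add, Real.logb_zero]
    exact Real.logb_le_logb_of_le one_lt_two (by positivity) (by linarith [a.cast_nonneg (α := ℝ)])
  · have hn' : (1 : ℝ) ≤ n := by exact_mod_cast hn
    rw [← Real.logb_mul (by positivity) (by positivity)]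
    refine Real.logb_le_logb_of_le one_lt_two (by positivity) ?_
    nlinarith [b.cast_nonneg (α := ℝ)]

/-- For every protocol `Π` and every cell `(x,y)` of the domain:
`I(x : y ∣ Π) ≥ I(x : y ∣ t_{x,y}, Π) - log₂ ρ(t_{x,y}) - d·log₂ n - d`. -/
theorem stmt1 (U : Machine) (hU : IsUniversal U) :
    ∃ d : ℝ, ∀ n₁ n₂ : ℕ, ∀ P : Protocol n₁ n₂, ∀ x y : List Bool,
      x.length = n₁ → y.length = n₂ →
      MI U x y (encProt P) ≥
        MI U x y (ePair (encRect (P.trans x y)) (encProt P))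
          - Real.logb 2 (rectThick P (P.trans x y))
          - d * Real.logb 2 (max n₁ n₂) - d := by
  obtain ⟨c, hc⟩ := hU.exists_KC_le_length
  obtain ⟨C, hC⟩ := hU.exists_KC_add_le
  obtain ⟨D, hD0, hD⟩ := exists_log_affine_le 5 (3 * c + 3)
  refine ⟨36 * (D + 2) + C + 1, fun n₁ n₂ P x y hx hy => ?_⟩
  set R := P.trans x y
  have hRP : R ∈ P.rects := P.trans_mem x y hx hy
  have hxR : x ∈ R.rows := P.trans_row x y hx hy
  have hyR : y ∈ R.cols := P.trans_col x y hx hy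
  set n := max n₁ n₂ with hn
  have hxn : x.length ≤ n := by omega
  have hyn : y.length ≤ n := by omega
  have hρ : rectThick P R ≠ 0 := by
    have h : 0 < cellThick P x y := List.countP_pos_iff.2 ⟨R, hRP, by simp [hxR, hyR]⟩
    exact (h.trans_le (cellThick_le_rectThick P hxR hyR)).ne'
  rw [← Nat.cast_max, ← hn]
  have hlog : 0 ≤ Real.logb 2 n := by
    rcases Nat.eq_zero_or_pos n with h | h
    · simp [h]
    · exact Real.logb_nonneg one_lt_two (by exact_mod_cast h)
  have hD2 : (36 * (Real.logb 2 n + D + 1) + C + 1) ≤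
      (36 * (D + 2) + C + 1) * Real.logb 2 n + (36 * (D + 2) + C + 1) := by
    have : 0 ≤ (36 * (D + 1) + C + 1) * Real.logb 2 n := by positivity
    linarith
  have hk : (Nat.log 2 (rectThick P R) : ℝ) ≤ Real.logb 2 (rectThick P R) :=
    Real.natLog_le_logb _ _
  set k := Nat.log 2 (rectThick P R)
  unfold MI
  have hxu := hc x (encProt P)
  have hyu := hc y (encProt P)
  by_cases hkB : k ≤ 5 * n + 3 * c + 2
  · have h2 : 5 * n + (3 * c + 3) + 1 < 2 ^ (Nat.log 2 (5 * n + (3 * c + 3) + 1) + 1) :=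
      Nat.lt_pow_succ_log_self one_lt_two _
    have key := hC n₁ n₂ P R x y (ePair x y) (k + 1) (Nat.log 2 (5 * n + (3 * c + 3) + 1) + 1)
      hRP hxR hyR (Nat.lt_pow_succ_log_self one_lt_two _).le (by omega) (by omega) (by omega)
    have key' : (_ : ℝ) ≤ _ := Nat.cast_le.2 key
    push_cast at key'
    have := hD n
    linarith
  · have hxw := hc x (ePair (encRect R) (encProt P))
    have hyw := hc y (ePair (encRect R) (encProt P))
    have hxy := hc (ePair x y) (encProt P)
    rw [length_ePair] at hxy
    have key : KC U x (ePair (encRect R) (encProt P)) + KC U y (ePair (encRect R) (encProt P)) +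
        KC U (ePair x y) (encProt P) ≤ k + KC U x (encProt P) + KC U y (encProt P) +
        KC U (ePair x y) (ePair (encRect R) (encProt P)) := by omega
    have key' : (_ : ℝ) ≤ _ := Nat.cast_le.2 key
    push_cast at key'
    have : (0 : ℝ) ≤ 36 * (Real.logb 2 n + D + 1) + C + 1 := by positivity
    linarith
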